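/- arXiv:2310.18477 — 2 statements merged into one kernel-verified Lean document; each statement's English description precedes it below -/
import Mathlib

section
/- Let C ≥ 2 and d be positive natural numbers, J > 0 a real number, y_i ≠ y_j two distinct classes in Fin C, and x_i, x_j ∈ ℝ^d. Let h⁰ and h¹ map each point of ℝ^d to a probability vector on Fin C and suppose: (i) |h⁰_{y_i}(x_i) − h⁰_{y_i}(x_j)| ≤ 1/J and |h¹_{y_j}(x_i) − h¹_{y_j}(x_j)| ≤ 1/J; (ii) h⁰_{y_i}(x_i) ≥ 1/2 + 1/J and h¹_{y_j}(x_j) ≥ 1/2 + 1/J; (iii) h⁰_{y_i}(x_j) ≤ 1/2 + 1/J and h¹_{y_j}(x_i) ≤ 1/2 + 1/J. Then the max ensemble g defined by g_c(x) = max(h⁰_c(x), h¹_c(x)) satisfies g_c(x_i) ≤ g_{y_i}(x_i) for every c ≠ y_i and g_c(x_j) ≤ g_{y_j}(x_j) for every c ≠ y_j; consequently the empirical 0-1 loss of g on the dataset {(x_i, y_i), (x_j, y_j)} equals 0. -/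
open Finset

/-- `maxOther hC f y` is `max_{c ≠ y} f c`, the largest predicted score among the
classes different from `y` (well-defined since `C ≥ 2`). -/
noncomputable def maxOther {C : ℕ} (hC : 2 ≤ C) (f : Fin C → ℝ) (y : Fin C) : ℝ :=
  (Finset.univ.filter (fun c => c ≠ y)).sup'
    (by
      obtain ⟨c, hc⟩ := Fintype.exists_ne_of_one_lt_card (by rw [Fintype.card_fin]; omega) y
      exact ⟨c, by simp [hc]⟩) f

theorem add_le_one_of_sum_eq_one {ι : Type*} [Fintype ι] {p : ι → ℝ}
    (hp : ∀ c, 0 ≤ p c) (hsum : ∑ c, p c = 1) {a b : ι} (hab : a ≠ b) : p a + p b ≤ 1 := by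
  classical
  rw [← hsum, ← Finset.sum_pair hab]
  exact Finset.sum_le_sum_of_subset_of_nonneg (Finset.subset_univ _) fun c _ _ => hp c

/-- If `p` gives `a` mass at least `1 / 2 + ε`, and `q` gives `b` mass between `1 / 2` and
`1 / 2 + ε`, then `a` maximizes the pointwise maximum of `p` and `q`. -/
theorem max_le_max_of_confident {ι : Type*} [Fintype ι] {p q : ι → ℝ} {ε : ℝ} {a b : ι}
    (hp : ∀ c, 0 ≤ p c) (hpsum : ∑ c, p c = 1) (hq : ∀ c, 0 ≤ q c) (hqsum : ∑ c, q c = 1)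
    (hε : 0 ≤ ε) (hpa : 1 / 2 + ε ≤ p a) (hqb : 1 / 2 ≤ q b) (hqb' : q b ≤ 1 / 2 + ε)
    {c : ι} (hc : c ≠ a) : max (p c) (q c) ≤ max (p a) (q a) := by
  refine le_trans (max_le ?_ ?_) (le_max_left _ _)
  · linarith [add_le_one_of_sum_eq_one hp hpsum hc]
  · rcases eq_or_ne c b with rfl | hcb
    · exact hqb'.trans hpa
    · linarith [add_le_one_of_sum_eq_one hq hqsum hcb]

theorem maxOther_le {C : ℕ} (hC : 2 ≤ C) {f : Fin C → ℝ} {y : Fin C}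
    (h : ∀ c, c ≠ y → f c ≤ f y) : maxOther hC f y ≤ f y :=
  Finset.sup'_le _ _ fun c hc => h c (Finset.mem_filter.mp hc).2

/-- Full Case III of the ensemble analysis in Theorem 5.1 for the max combiner:
each base classifier confidently classifies one example of an ambiguous pair and mildly
misclassifies the other; the max ensemble then classifies both examples correctly,
yielding empirical 0-1 loss `0` on the pair. -/
theorem max_ensemble_zero_loss_on_ambiguous_pair
    (d C : ℕ) (hd : 0 < d) (hC : 2 ≤ C) (J : ℝ) (hJ : 0 < J)
    (yi yj : Fin C) (hy : yi ≠ yj)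
    (xi xj : EuclideanSpace ℝ (Fin d))
    (h0 h1 : EuclideanSpace ℝ (Fin d) → Fin C → ℝ)
    (h0pos : ∀ x c, 0 ≤ h0 x c) (h0sum : ∀ x, ∑ c, h0 x c = 1)
    (h1pos : ∀ x c, 0 ≤ h1 x c) (h1sum : ∀ x, ∑ c, h1 x c = 1)
    (hi0 : |h0 xi yi - h0 xj yi| ≤ 1 / J) (hi1 : |h1 xi yj - h1 xj yj| ≤ 1 / J)
    (hii0 : h0 xi yi ≥ 1 / 2 + 1 / J) (hii1 : h1 xj yj ≥ 1 / 2 + 1 / J)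
    (hiii0 : h0 xj yi ≤ 1 / 2 + 1 / J) (hiii1 : h1 xi yj ≤ 1 / 2 + 1 / J) :
    ∀ g : EuclideanSpace ℝ (Fin d) → Fin C → ℝ,
      (∀ x c, g x c = max (h0 x c) (h1 x c)) →
      (∀ c, c ≠ yi → g xi c ≤ g xi yi) ∧
      (∀ c, c ≠ yj → g xj c ≤ g xj yj) ∧
      ((if g xi yi < maxOther hC (g xi) yi then (1 : ℝ) else 0) +
        (if g xj yj < maxOther hC (g xj) yj then (1 : ℝ) else 0)) / 2 = 0 := by
  intro g hg
  have hε : 0 ≤ 1 / J := by positivity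
  have hgi : ∀ c, c ≠ yi → g xi c ≤ g xi yi := fun c hc => by
    rw [hg, hg]
    exact max_le_max_of_confident (h0pos xi) (h0sum xi) (h1pos xi) (h1sum xi) hε hii0
      (by linarith [(abs_le.mp hi1).1]) hiii1 hc
  have hgj : ∀ c, c ≠ yj → g xj c ≤ g xj yj := fun c hc => by
    rw [hg, hg, max_comm (h0 xj c), max_comm (h0 xj yj)]
    exact max_le_max_of_confident (h1pos xj) (h1sum xj) (h0pos xj) (h0sum xj) hε hii1
      (by linarith [(abs_le.mp hi0).2]) hiii0 hc
  refine ⟨hgi, hgj, ?_⟩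
  rw [if_neg (maxOther_le hC hgi).not_gt, if_neg (maxOther_le hC hgj).not_gt]
  norm_num
end

section
/- Let C ≥ 2 and d be positive natural numbers, J > 0 a real number, y_i ≠ y_j two distinct classes in Fin C, and x_i, x_j ∈ ℝ^d. Let h⁰ and h¹ map each point of ℝ^d to a probability vector on Fin C, and suppose |h⁰_{y_i}(x_i) − h⁰_{y_i}(x_j)| ≤ 1/J, |h¹_{y_i}(x_i) − h¹_{y_i}(x_j)| ≤ 1/J, h⁰_{y_i}(x_i) > 1/2 + 1/J and h¹_{y_i}(x_i) > 1/2 + 1/J. Then both the average ensemble g = (h⁰ + h¹)/2 and the max ensemble g_c(x) = max(h⁰_c(x), h¹_c(x)) correctly classify x_i (g_{y_i}(x_i) > g_c(x_i) for every c ≠ y_i) and misclassify x_j into class y_i (g_{y_i}(x_j) > g_c(x_j) for every c ≠ y_i, in particular g_{y_j}(x_j) < g_{y_i}(x_j)); consequently each ensemble's empirical 0-1 loss on the dataset {(x_i, y_i), (x_j, y_j)} equals 1/2. -/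
open Finset

/-- If `f` is below `f y` off `y`, then `y` is correctly classified. -/
theorem maxOther_lt {C : ℕ} (hC : 2 ≤ C) {f : Fin C → ℝ} {y : Fin C}
    (h : ∀ c, c ≠ y → f c < f y) : maxOther hC f y < f y := by
  simpa [maxOther, Finset.sup'_lt_iff] using h

theorem le_maxOther {C : ℕ} (hC : 2 ≤ C) (f : Fin C → ℝ) {y c : Fin C} (h : c ≠ y) :
    f c ≤ maxOther hC f y :=
  Finset.le_sup' f (by simp [h])

/-- Two points with distinct labels that are both strictly classified as the first label
have average 0-1 loss `1 / 2`. -/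
theorem pair_loss_eq_half {C : ℕ} (hC : 2 ≤ C) {f f' : Fin C → ℝ} {y y' : Fin C}
    (hy : y ≠ y') (hf : ∀ c, c ≠ y → f c < f y) (hf' : ∀ c, c ≠ y → f' c < f' y) :
    ((if f y < maxOther hC f y then (1 : ℝ) else 0) +
      (if f' y' < maxOther hC f' y' then (1 : ℝ) else 0)) / 2 = 1 / 2 := by
  rw [if_neg (maxOther_lt hC hf).not_gt,
    if_pos ((hf' y' hy.symm).trans_le (le_maxOther hC f' hy)), zero_add]

/-- In a probability vector, an entry above `1 / 2` forces all others below `1 / 2`. -/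
theorem lt_half_of_half_lt {ι : Type*} [Fintype ι] {p : ι → ℝ} (hpos : ∀ c, 0 ≤ p c)
    (hsum : ∑ c, p c = 1) {y c : ι} (hy : 1 / 2 < p y) (hc : c ≠ y) : p c < 1 / 2 := by
  have := Finset.add_le_sum (fun i _ => hpos i) (Finset.mem_univ c) (Finset.mem_univ y) hc
  linarith

/-- Cases I/II of the ensemble analysis in Theorem 5.1: when both base classifiers
confidently classify `x_i` into its true class `y_i`, both the average-combined and the
max-combined ensembles correctly classify `x_i` and misclassify the neighbouring
example `x_j` into `y_i`, giving ensemble empirical 0-1 loss exactly `1/2` on the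
ambiguous pair. -/
theorem ensemble_half_loss_when_both_confident_on_xi
    (d C : ℕ) (hd : 0 < d) (hC : 2 ≤ C) (J : ℝ) (hJ : 0 < J)
    (yi yj : Fin C) (hy : yi ≠ yj)
    (xi xj : EuclideanSpace ℝ (Fin d))
    (h0 h1 : EuclideanSpace ℝ (Fin d) → Fin C → ℝ)
    (h0pos : ∀ x c, 0 ≤ h0 x c) (h0sum : ∀ x, ∑ c, h0 x c = 1)
    (h1pos : ∀ x c, 0 ≤ h1 x c) (h1sum : ∀ x, ∑ c, h1 x c = 1)
    (hlip0 : |h0 xi yi - h0 xj yi| ≤ 1 / J) (hlip1 : |h1 xi yi - h1 xj yi| ≤ 1 / J)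
    (hconf0 : h0 xi yi > 1 / 2 + 1 / J) (hconf1 : h1 xi yi > 1 / 2 + 1 / J) :
    ∀ g gm : EuclideanSpace ℝ (Fin d) → Fin C → ℝ,
      (∀ x c, g x c = (h0 x c + h1 x c) / 2) →
      (∀ x c, gm x c = max (h0 x c) (h1 x c)) →
      ((∀ c, c ≠ yi → g xi c < g xi yi) ∧
       (∀ c, c ≠ yi → g xj c < g xj yi) ∧
       g xj yj < g xj yi ∧
       ((if g xi yi < maxOther hC (g xi) yi then (1 : ℝ) else 0) +
         (if g xj yj < maxOther hC (g xj) yj then (1 : ℝ) else 0)) / 2 = 1 / 2) ∧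
      ((∀ c, c ≠ yi → gm xi c < gm xi yi) ∧
       (∀ c, c ≠ yi → gm xj c < gm xj yi) ∧
       gm xj yj < gm xj yi ∧
       ((if gm xi yi < maxOther hC (gm xi) yi then (1 : ℝ) else 0) +
         (if gm xj yj < maxOther hC (gm xj) yj then (1 : ℝ) else 0)) / 2 = 1 / 2) := by
  intro g gm hg hgm
  have hJ' : 0 < 1 / J := one_div_pos.mpr hJ
  have h0i : 1 / 2 < h0 xi yi := by linarith
  have h1i : 1 / 2 < h1 xi yi := by linarith
  have h0j : 1 / 2 < h0 xj yi := by linarith [(abs_le.mp hlip0).2]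
  have h1j : 1 / 2 < h1 xj yi := by linarith [(abs_le.mp hlip1).2]
  have avg_lt : ∀ x, 1 / 2 < h0 x yi → 1 / 2 < h1 x yi → ∀ c, c ≠ yi → g x c < g x yi := by
    intro x hx0 hx1 c hc
    rw [hg, hg]
    linarith [lt_half_of_half_lt (h0pos x) (h0sum x) hx0 hc,
      lt_half_of_half_lt (h1pos x) (h1sum x) hx1 hc]
  have max_lt' : ∀ x, 1 / 2 < h0 x yi → 1 / 2 < h1 x yi → ∀ c, c ≠ yi → gm x c < gm x yi := by
    intro x hx0 hx1 c hc
    rw [hgm, hgm]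
    exact max_lt_max ((lt_half_of_half_lt (h0pos x) (h0sum x) hx0 hc).trans hx0)
      ((lt_half_of_half_lt (h1pos x) (h1sum x) hx1 hc).trans hx1)
  have gi := avg_lt xi h0i h1i
  have gj := avg_lt xj h0j h1j
  have gmi := max_lt' xi h0i h1i
  have gmj := max_lt' xj h0j h1j
  exact ⟨⟨gi, gj, gj yj hy.symm, pair_loss_eq_half hC hy gi gj⟩,
    gmi, gmj, gmj yj hy.symm, pair_loss_eq_half hC hy gmi gmj⟩
end
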